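/- arXiv:2506.04407 — 2 statements merged into one kernel-verified Lean document; each statement's English description precedes it below -/
import Mathlib

section
/- Let k ≥ 4. If w is a factor of u_k of length 4 with π(w) = 0101, then w = 0101 (the word over A consisting of the letters 0, 1, 0, 1). -/
open List Filter Topology

/-- The alphabet `A`: the letter `(b, j)` is the unprimed letter `j` if `b = false`
and the primed letter `j′` if `b = true`.  Only letters with `j < k` occur. -/
abbrev Letter : Type := Bool × ℕ

/-- The morphism ξ_k on letters: `0 ↦ 01`, `j ↦ j+1` for `1 ≤ j ≤ k−2`, `k−1 ↦ 0′`,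
and symmetrically on primed letters with `(k−1)′ ↦ 0`. -/
def xiL (k : ℕ) (a : Letter) : List Letter :=
  if a.2 = 0 then [(a.1, 0), (a.1, 1)]
  else if a.2 = k - 1 then [(!a.1, 0)]
  else [(a.1, a.2 + 1)]

/-- The morphism ξ_k on finite words. -/
def xiW (k : ℕ) (w : List Letter) : List Letter := w.flatMap (xiL k)

/-- The word ξ_k^n(0). -/
def xiPow (k n : ℕ) : List Letter := (xiW k)^[n] [((false : Bool), (0 : ℕ))]

/-- The projection π : A → {0,1}, with `false` playing the role of `0` and
`true` the role of `1`. -/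
def proj (a : Letter) : Bool := if a.2 = 0 then a.1 else !a.1

/-- The twin map `ℓ ↔ ℓ′` on letters. -/
def twin (a : Letter) : Letter := (!a.1, a.2)

/-- The finite word `w` occurs in the infinite word `v` at position `j`. -/
def OccursAt {α : Type*} (w : List α) (v : ℕ → α) (j : ℕ) : Prop :=
  ∀ i, i < w.length → w[i]? = some (v (j + i))

/-- The finite word `w` is a prefix of the infinite word `v`. -/
def PrefixSeq {α : Type*} (w : List α) (v : ℕ → α) : Prop := OccursAt w v 0

/-- The finite word `w` is a factor of the infinite word `v`. -/
def FactorOf {α : Type*} (w : List α) (v : ℕ → α) : Prop := ∃ j, OccursAt w v j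

/-- `v` is the fixed point `u_k = ξ_k^ω(0)`: every `ξ_k^n(0)` is a prefix of `v`. -/
def IsFixedPoint (k : ℕ) (v : ℕ → Letter) : Prop := ∀ n, PrefixSeq (xiPow k n) v

/-- `q ≥ 1` is a period of the finite word `z`. -/
def HasPeriod {α : Type*} (z : List α) (q : ℕ) : Prop :=
  1 ≤ q ∧ ∀ i, i + q < z.length → z[i]? = z[i + q]?

/-- `w` is a left special factor of the infinite word `v`. -/
def LeftSpecial {α : Type*} (w : List α) (v : ℕ → α) : Prop :=
  ∃ a b : α, a ≠ b ∧ FactorOf (a :: w) v ∧ FactorOf (b :: w) v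

/-- `w` is a right special factor of the infinite word `v`. -/
def RightSpecial {α : Type*} (w : List α) (v : ℕ → α) : Prop :=
  ∃ a b : α, a ≠ b ∧ FactorOf (w ++ [a]) v ∧ FactorOf (w ++ [b]) v

/-- `w` is a bispecial factor of the infinite word `v`. -/
def Bispecial {α : Type*} (w : List α) (v : ℕ → α) : Prop :=
  LeftSpecial w v ∧ RightSpecial w v

/-- The set of left extensions of `w` in `v`. -/
def Lext {α : Type*} (w : List α) (v : ℕ → α) : Set α := {a | FactorOf (a :: w) v}

/-- The set of right extensions of `w` in `v`. -/
def Rext {α : Type*} (w : List α) (v : ℕ → α) : Set α := {a | FactorOf (w ++ [a]) v}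

/-- `r` is a return word to `w` in `v`: it spans two consecutive occurrences of `w`. -/
def ReturnWordTo {α : Type*} (r w : List α) (v : ℕ → α) : Prop :=
  ∃ j ℓ, j < ℓ ∧ OccursAt w v j ∧ OccursAt w v ℓ ∧
    (∀ m, j < m → m < ℓ → ¬ OccursAt w v m) ∧
    r = (List.range (ℓ - j)).map (fun i => v (j + i))

/-- The factor complexity of an infinite word. -/
noncomputable def complexity {α : Type*} (v : ℕ → α) (n : ℕ) : ℕ :=
  {w : List α | w.length = n ∧ FactorOf w v}.ncard

theorem exists_xiPow_eq_cons (k n : ℕ) :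
    ∃ t, xiPow k n = (false, 0) :: t ∧ n ≤ t.length := by
  induction n with
  | zero => exact ⟨[], rfl, le_rfl⟩
  | succ n ih =>
    obtain ⟨t, ht, hn⟩ := ih
    have hlen : ∀ l : List Letter, l.length ≤ (xiW k l).length := by
      intro l
      induction l with
      | nil => simp
      | cons a l ih =>
        have : 1 ≤ (xiL k a).length := by unfold xiL; split_ifs <;> simp
        simp only [xiW, List.flatMap_cons, List.length_append, List.length_cons] at ih ⊢
        omega
    refine ⟨(false, 1) :: xiW k t, ?_, ?_⟩
    · have : xiPow k (n + 1) = xiW k (xiPow k n) := Function.iterate_succ_apply' _ _ _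
      rw [this, ht]
      simp [xiW, xiL]
    · have := hlen t
      simp only [List.length_cons]
      omega

theorem IsFixedPoint.prefixSeq_xiW {k : ℕ} {u : ℕ → Letter} (hu : IsFixedPoint k u) (i : ℕ) :
    PrefixSeq (xiW k ((List.range i).map u)) u := by
  obtain ⟨t, ht, hi⟩ := exists_xiPow_eq_cons k i
  have hpre : (List.range i).map u <+: xiPow k i := by
    rw [List.prefix_iff_getElem?]
    intro m hm
    have hm' : m < i := by simpa using hm
    have := hu i m (by rw [ht, List.length_cons]; omega)
    rw [this]
    simp
  obtain ⟨r, hr⟩ := hpre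
  have hsucc : xiPow k (i + 1) = xiW k ((List.range i).map u) ++ xiW k r := by
    have : xiPow k (i + 1) = xiW k (xiPow k i) := Function.iterate_succ_apply' _ _ _
    rw [this, ← hr]
    simp [xiW]
  intro m hm
  have := hu (i + 1) m (by rw [hsucc, List.length_append]; omega)
  rwa [hsucc, List.getElem?_append_left hm] at this

/-- `s` lists the starting positions in `u` of the blocks `ξ_k(u_0), ξ_k(u_1), …`. -/
structure IsCutting (k : ℕ) (u : ℕ → Letter) (s : ℕ → ℕ) : Prop where
  start : u 0 = (false, 0)
  zero : s 0 = 0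
  of_zero : ∀ i, (u i).2 = 0 →
    s (i + 1) = s i + 2 ∧ u (s i) = ((u i).1, 0) ∧ u (s i + 1) = ((u i).1, 1)
  of_last : ∀ i, (u i).2 ≠ 0 → (u i).2 = k - 1 →
    s (i + 1) = s i + 1 ∧ u (s i) = (!(u i).1, 0)
  of_middle : ∀ i, (u i).2 ≠ 0 → (u i).2 ≠ k - 1 →
    s (i + 1) = s i + 1 ∧ u (s i) = ((u i).1, (u i).2 + 1)

theorem IsFixedPoint.exists_isCutting {k : ℕ} {u : ℕ → Letter} (hu : IsFixedPoint k u) :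
    ∃ s, IsCutting k u s := by
  let s : ℕ → ℕ := fun i => (xiW k ((List.range i).map u)).length
  have happ : ∀ i, xiW k ((List.range (i + 1)).map u) =
      xiW k ((List.range i).map u) ++ xiL k (u i) := by
    intro i
    simp [xiW, List.range_succ]
  have hs : ∀ i, s (i + 1) = s i + (xiL k (u i)).length := by
    intro i
    simp only [s, happ, List.length_append]
  have hget : ∀ i t, t < (xiL k (u i)).length → (xiL k (u i))[t]? = some (u (s i + t)) := by
    intro i t ht
    have := hu.prefixSeq_xiW (i + 1) (s i + t) (by
      change s i + t < s (i + 1)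
      rw [hs]; omega)
    rw [happ, List.getElem?_append_right (by simp [s])] at this
    simpa [s] using this
  refine ⟨s, ?_, rfl, fun i h => ?_, fun i h h' => ?_, fun i h h' => ?_⟩
  · have := hu 0 0 (by simp [xiPow])
    simpa [xiPow] using this.symm
  · have e : xiL k (u i) = [((u i).1, 0), ((u i).1, 1)] := by simp [xiL, h]
    have h0 := hget i 0 (by simp [e])
    have h1 := hget i 1 (by simp [e])
    have h2 := hs i
    simp only [e, List.length_cons, List.length_nil, List.getElem?_cons_zero,
      List.getElem?_cons_succ, Option.some.injEq] at h0 h1 h2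
    exact ⟨h2, h0.symm, h1.symm⟩
  · have e : xiL k (u i) = [(!(u i).1, 0)] := by
      unfold xiL
      rw [if_neg h, if_pos h']
    have h0 := hget i 0 (by simp [e])
    have h2 := hs i
    simp only [e, List.length_cons, List.length_nil, List.getElem?_cons_zero,
      Option.some.injEq] at h0 h2
    exact ⟨h2, h0.symm⟩
  · have e : xiL k (u i) = [((u i).1, (u i).2 + 1)] := by
      unfold xiL
      rw [if_neg h, if_neg h']
    have h0 := hget i 0 (by simp [e])
    have h2 := hs i
    simp only [e, List.length_cons, List.length_nil, List.getElem?_cons_zero,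
      Option.some.injEq] at h0 h2
    exact ⟨h2, h0.symm⟩

namespace IsCutting

variable {k : ℕ} {u : ℕ → Letter} {s : ℕ → ℕ}

theorem succ_cases (h : IsCutting k u s) (i : ℕ) :
    s (i + 1) = s i + 1 ∨ (s (i + 1) = s i + 2 ∧ (u i).2 = 0) := by
  by_cases h0 : (u i).2 = 0
  · exact Or.inr ⟨(h.of_zero i h0).1, h0⟩
  · by_cases h1 : (u i).2 = k - 1
    · exact Or.inl (h.of_last i h0 h1).1
    · exact Or.inl (h.of_middle i h0 h1).1

theorem lt_apply (h : IsCutting k u s) (i : ℕ) : i + 1 < s (i + 1) := by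
  induction i with
  | zero =>
    have := (h.of_zero 0 (by rw [h.start])).1
    rw [h.zero] at this
    omega
  | succ i ih =>
    have := h.succ_cases (i + 1)
    omega

theorem exists_block (h : IsCutting k u s) (n : ℕ) :
    ∃ i, s i = n ∨ (s i + 1 = n ∧ (u i).2 = 0) := by
  induction n with
  | zero => exact ⟨0, Or.inl h.zero⟩
  | succ n ih =>
    obtain ⟨i, hi | ⟨hi, h0⟩⟩ := ih
    · rcases h.succ_cases i with hs | ⟨hs, h0⟩
      · exact ⟨i + 1, Or.inl (by omega)⟩
      · exact ⟨i, Or.inr ⟨by omega, h0⟩⟩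
    · have := (h.of_zero i h0).1
      exact ⟨i + 1, Or.inl (by omega)⟩

theorem snd_lt (h : IsCutting k u s) (hk : 2 ≤ k) (n : ℕ) : (u n).2 < k := by
  induction n using Nat.strong_induction_on with
  | _ n ih =>
    obtain ⟨i, rfl | ⟨rfl, h0⟩⟩ := h.exists_block n
    · rcases i with _ | i
      · rw [h.zero, h.start]
        simp only
        omega
      · have hb := ih (i + 1) (h.lt_apply i)
        by_cases h0 : (u (i + 1)).2 = 0
        · rw [(h.of_zero _ h0).2.1]
          simp only
          omega
        · by_cases h1 : (u (i + 1)).2 = k - 1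
          · rw [(h.of_last _ h0 h1).2]
            simp only
            omega
          · rw [(h.of_middle _ h0 h1).2]
            simp only
            omega
    · rw [(h.of_zero _ h0).2.2]
      simp only
      omega

/-- A letter is followed by its successor of the same kind or by one of `0`, `0′`. -/
theorem succ_eq_zero_or (h : IsCutting k u s) (hk : 3 ≤ k) (n : ℕ) :
    (u (n + 1)).2 = 0 ∨ u (n + 1) = ((u n).1, (u n).2 + 1) := by
  induction n using Nat.strong_induction_on with
  | _ n ih =>
    obtain ⟨i, hi | ⟨hi, h0⟩⟩ := h.exists_block (n + 1)
    · rcases i with _ | i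
      · have := h.zero
        omega
      · have hlt := h.lt_apply i
        have hb := h.snd_lt (by omega) (i + 1)
        rw [← hi]
        rcases ih i (by omega) with hz | hz
        · exact Or.inl (by rw [(h.of_zero _ hz).2.1])
        · have hne : (u (i + 1)).2 ≠ 0 := by rw [hz]; simp
          by_cases h1 : (u (i + 1)).2 = k - 1
          · exact Or.inl (by rw [(h.of_last _ hne h1).2])
          · right
            rw [(h.of_middle _ hne h1).2]
            rw [hz] at hb h1 ⊢
            simp only at hb h1 ⊢
            by_cases h0 : (u i).2 = 0
            · obtain ⟨a, -, c⟩ := h.of_zero i h0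
              obtain rfl : n = s i + 1 := by omega
              rw [c, h0]
            · obtain ⟨a, c⟩ := h.of_middle i h0 (by omega)
              obtain rfl : n = s i := by omega
              rw [c]
    · obtain ⟨-, b, c⟩ := h.of_zero i h0
      obtain rfl : n = s i := by omega
      right
      rw [c, b]

theorem exists_block_of_snd_eq_zero (h : IsCutting k u s) {n : ℕ} (hn : (u n).2 = 0) :
    ∃ i, s i = n := by
  obtain ⟨i, hi | ⟨rfl, h0⟩⟩ := h.exists_block n
  · exact ⟨i, hi⟩
  · rw [(h.of_zero i h0).2.2] at hn
    simp at hn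

/-- Two consecutive letters from `{0, 0′}` are preceded by `k - 1` or `(k - 1)′`. -/
theorem eq_last_of_zero_zero (h : IsCutting k u s) (hk : 3 ≤ k) {n : ℕ}
    (h₁ : (u (n + 1)).2 = 0) (h₂ : (u (n + 2)).2 = 0) :
    u n = (!(u (n + 1)).1, k - 1) := by
  obtain ⟨i, hi⟩ := h.exists_block_of_snd_eq_zero h₁
  rcases i with _ | i
  · have := h.zero
    omega
  have hne : (u (i + 1)).2 ≠ 0 := by
    intro h0
    have := (h.of_zero _ h0).2.2
    rw [hi] at this
    rw [show n + 2 = n + 1 + 1 from rfl, this] at h₂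
    simp at h₂
  have hlast : (u (i + 1)).2 = k - 1 := by
    by_contra hl
    have := (h.of_middle _ hne hl).2
    rw [hi] at this
    rw [this] at h₁
    simp at h₁
  have hfst := (h.of_last _ hne hlast).2
  rw [hi] at hfst
  have hprev := (h.succ_eq_zero_or hk i).resolve_left hne
  rw [hprev] at hlast
  simp only at hlast
  obtain ⟨a, b⟩ := h.of_middle i (by omega) (by omega)
  obtain rfl : s i = n := by omega
  rw [b, hfst, hprev, hlast]
  simp

/-- A factor `0 1 0` of letters of the same kind is preceded by the `0` of that kind. -/
theorem eq_zero_of_zero_one_zero (h : IsCutting k u s) (hk : 3 ≤ k) {n : ℕ} {b : Bool}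
    (h₁ : u (n + 1) = (b, 0)) (h₂ : u (n + 2) = (b, 1)) (h₃ : u (n + 3) = (b, 0)) :
    u n = (b, 0) := by
  obtain ⟨i, hi⟩ := h.exists_block_of_snd_eq_zero (n := n + 1) (by rw [h₁])
  rcases i with _ | i
  · have := h.zero
    omega
  have h0 : (u (i + 1)).2 = 0 := by
    by_contra hne
    rcases h.succ_cases (i + 1) with hs | ⟨-, h0⟩
    · have e : s (i + 1 + 1) = n + 2 := by omega
      by_cases h0 : (u (i + 1 + 1)).2 = 0
      · have := (h.of_zero _ h0).2.1
        rw [e, h₂] at this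
        simp at this
      · by_cases hl : (u (i + 1 + 1)).2 = k - 1
        · have := (h.of_last _ h0 hl).2
          rw [e, h₂] at this
          simp at this
        · have := (h.of_middle _ h0 hl).2
          rw [e, h₂] at this
          simp only [Prod.mk.injEq] at this
          omega
    · exact hne h0
  obtain ⟨a, c, -⟩ := h.of_zero _ h0
  rw [hi] at a c
  have hb : (u (i + 1)).1 = b := by
    rw [h₁] at c
    simpa using c.symm
  have h0' : (u (i + 2)).2 = 0 := by
    rcases h.succ_eq_zero_or hk (i + 1) with hz | hz
    · exact hz
    · have := (h.of_middle (i + 2) (by rw [hz]; simp) (by rw [hz, h0]; simp only; omega)).2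
      rw [show s (i + 2) = n + 3 by omega, h₃] at this
      simp at this
  have hprev := h.eq_last_of_zero_zero hk h0 h0'
  obtain ⟨d, e⟩ := h.of_last i (by rw [hprev]; simp only; omega) (by rw [hprev])
  obtain rfl : s i = n := by omega
  rw [e, hprev, hb]
  simp

end IsCutting

/-- for `k ≥ 4`, if `w` is a factor of `u_k` of length `4` with
`π(w) = 0101`, then `w = 0101`. -/
theorem stmt_10 (k : ℕ) (hk : 4 ≤ k) (u : ℕ → Letter) (hu : IsFixedPoint k u) :
    ∀ w : List Letter, FactorOf w u → w.length = 4 →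
      w.map proj = [false, true, false, true] →
      w = [((false : Bool), (0 : ℕ)), (false, 1), (false, 0), (false, 1)] := by
  rintro w ⟨j, hw⟩ hlen hπ
  obtain ⟨s, hs⟩ := hu.exists_isCutting
  obtain ⟨a, b, c, d, rfl⟩ : ∃ a b c d, w = [a, b, c, d] := by
    match w, hlen with
    | [a, b, c, d], _ => exact ⟨a, b, c, d, rfl⟩
  have ha : a = u j := by simpa using hw 0 (by simp)
  have hb : b = u (j + 1) := by simpa using hw 1 (by simp)
  have hc : c = u (j + 2) := by simpa using hw 2 (by simp)
  have hd : d = u (j + 3) := by simpa using hw 3 (by simp)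
  have p₁ := hs.succ_eq_zero_or (by omega) j
  have p₂ := hs.succ_eq_zero_or (by omega) (j + 1)
  have p₃ := hs.succ_eq_zero_or (by omega) (j + 2)
  have z₁ := hs.eq_last_of_zero_zero (n := j) (by omega)
  have z₂ := hs.eq_last_of_zero_zero (n := j + 1) (by omega)
  have q := hs.eq_zero_of_zero_one_zero (n := j) (b := true) (by omega)
  simp only [add_assoc, Nat.reduceAdd] at p₂ p₃ z₂
  rw [← ha, ← hb] at p₁
  rw [← hb, ← hc] at p₂
  rw [← hc, ← hd] at p₃
  rw [← ha, ← hb, ← hc] at z₁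
  rw [← hb, ← hc, ← hd] at z₂
  rw [← ha, ← hb, ← hc, ← hd] at q
  clear ha hb hc hd hw
  obtain ⟨a₁, a₂⟩ := a
  obtain ⟨b₁, b₂⟩ := b
  obtain ⟨c₁, c₂⟩ := c
  obtain ⟨d₁, d₂⟩ := d
  simp only [List.map_cons, List.map_nil, List.cons.injEq, and_true, proj] at hπ
  simp only [Prod.mk.injEq, List.cons.injEq, and_true] at *
  grind (splits := 30)
end

section
/- Let k ≥ 4. Let w ≠ ε be a bispecial factor of u_k, and suppose there exist two distinct letters x, y ∈ Rext(w) with π(x) = π(y). Then w or its twin equals ξ^ℓ(0) for some ℓ with 0 ≤ ℓ ≤ 2k−2 and ℓ ≠ k−1. -/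
open List Filter Topology

/-- The language of `u_k`, described through the words `ξ^n(0)`. -/
def Lang (k : ℕ) (w : List Letter) : Prop := ∃ n, w <:+: xiPow k n

/-- The word `ξ^n(0)` or its twin `ξ^n(0′)`, according to `r`. -/
def xiIter (k : ℕ) (r : Bool) (n : ℕ) : List Letter := (xiW k)^[n] [(r, 0)]

/-- Necessary condition for `ab` to be a factor of `u_k`. -/
def Adj (k : ℕ) (a b : Letter) : Prop := b.2 = 0 ∨ (b.1 = a.1 ∧ b.2 = a.2 + 1 ∧ b.2 < k)

/-- The first letter of `ξ(a)`. -/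
def xiHead (k : ℕ) (a : Letter) : Letter :=
  if a.2 = 0 then a else if a.2 = k - 1 then (!a.1, 0) else (a.1, a.2 + 1)

/-- The last letter of `ξ(a)`. -/
def xiLast (k : ℕ) (a : Letter) : Letter :=
  if a.2 = 0 then (a.1, 1) else if a.2 = k - 1 then (!a.1, 0) else (a.1, a.2 + 1)

lemma xiL_eq_cons (k : ℕ) (a : Letter) :
    ∃ t, xiL k a = xiHead k a :: t := by
  obtain ⟨s, i⟩ := a
  simp only [xiL, xiHead]
  split_ifs with h1 h2
  · simp_all
  · simp
  · simp

lemma xiL_eq_concat (k : ℕ) (a : Letter) :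
    ∃ t, xiL k a = t ++ [xiLast k a] := by
  obtain ⟨s, i⟩ := a
  simp only [xiL, xiLast]
  split_ifs with h1 h2
  · exact ⟨[(s, 0)], by simp⟩
  · exact ⟨[], by simp⟩
  · exact ⟨[], by simp⟩

lemma xiLast_injective {k : ℕ} : Function.Injective (xiLast k) := by
  rintro ⟨s, i⟩ ⟨t, j⟩ h
  simp only [xiLast] at h
  split_ifs at h <;> simp_all

@[simp] lemma xiW_nil (k : ℕ) : xiW k [] = [] := rfl

@[simp] lemma xiW_cons (k : ℕ) (a : Letter) (w : List Letter) :
    xiW k (a :: w) = xiL k a ++ xiW k w := rfl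

@[simp] lemma xiW_append (k : ℕ) (v w : List Letter) :
    xiW k (v ++ w) = xiW k v ++ xiW k w := by
  simp [xiW]

lemma xiW_iterate_append (k n : ℕ) (v w : List Letter) :
    (xiW k)^[n] (v ++ w) = (xiW k)^[n] v ++ (xiW k)^[n] w := by
  induction n generalizing v w with
  | zero => rfl
  | succ n ih => simp [ih]

lemma xiW_injective {k : ℕ} : Function.Injective (xiW k) := by
  intro v
  induction v using List.reverseRecOn with
  | nil =>
    intro w h
    cases w with
    | nil => rfl
    | cons b w =>
      obtain ⟨t, ht⟩ := xiL_eq_cons k b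
      simp [ht] at h
  | append_singleton v a ih =>
    intro w h
    rcases List.eq_nil_or_concat' w with rfl | ⟨w, b, rfl⟩
    · obtain ⟨t, ht⟩ := xiL_eq_cons k a
      simp [ht] at h
    · obtain ⟨t, ht⟩ := xiL_eq_concat k a
      obtain ⟨t', ht'⟩ := xiL_eq_concat k b
      have hl := congrArg List.getLast? h
      simp [ht, ht'] at hl
      obtain rfl := xiLast_injective hl
      simp at h
      rw [ih h]

lemma length_le_length_xiW (k : ℕ) (w : List Letter) : w.length ≤ (xiW k w).length := by
  induction w with
  | nil => simp
  | cons a w ih =>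
    obtain ⟨t, ht⟩ := xiL_eq_cons k a
    simp [ht]
    omega

/-- A cut of `ξ(V)` that does not precede a letter `1` or `1′` comes from a cut of `V`. -/
lemma exists_of_xiW_eq_append {k : ℕ} {V p q : List Letter} (h : xiW k V = p ++ q)
    (hq : ∀ c ∈ q.head?, c.2 ≠ 1) :
    ∃ V₁ V₂, V = V₁ ++ V₂ ∧ xiW k V₁ = p ∧ xiW k V₂ = q := by
  induction V generalizing p with
  | nil =>
    simp at h
    exact ⟨[], [], by simp [h]⟩
  | cons a V ih =>
    rcases p with _ | ⟨c, p⟩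
    · exact ⟨[], a :: V, by simpa using h⟩
    · have key : ∀ p', c :: p = xiL k a ++ p' → ∃ V₁ V₂, a :: V = V₁ ++ V₂ ∧
          xiW k V₁ = c :: p ∧ xiW k V₂ = q := by
        intro p' hp'
        rw [hp', xiW_cons, List.append_assoc] at h
        obtain ⟨V₁, V₂, rfl, h1, h2⟩ := ih (List.append_cancel_left h)
        exact ⟨a :: V₁, V₂, by simp [h1, h2, hp']⟩
      rw [xiW_cons] at h
      unfold xiL at h key
      split_ifs at h key with h1 h2
      · rcases p with _ | ⟨d, p⟩
        · simp at h
          obtain ⟨-, rfl⟩ := h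
          simp at hq
        · simp at h
          exact key p (by simp [← h.1, ← h.2.1])
      · simp at h
        exact key p (by simp [← h.1])
      · simp at h
        exact key p (by simp [← h.1])

lemma Adj.xiW {k : ℕ} {a b : Letter} (hk : 4 ≤ k) (h : Adj k a b) :
    Adj k (xiLast k a) (xiHead k b) := by
  obtain ⟨s, i⟩ := a
  obtain ⟨t, j⟩ := b
  simp only [Adj, xiLast, xiHead] at *
  split_ifs <;> simp_all <;> omega

lemma isChain_xiW {k : ℕ} (hk : 4 ≤ k) {V : List Letter} (h : V.IsChain (Adj k)) :
    (xiW k V).IsChain (Adj k) := by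
  have hL : ∀ a, (xiL k a).IsChain (Adj k) := by
    intro a
    unfold xiL
    split_ifs
    · simp [Adj]; omega
    · simp
    · simp
  induction V with
  | nil => simp
  | cons a V ih =>
    rw [xiW_cons, List.isChain_append]
    refine ⟨hL a, ih h.of_cons, ?_⟩
    obtain ⟨t, ht⟩ := xiL_eq_concat k a
    rcases V with _ | ⟨b, V⟩
    · simp
    · obtain ⟨t', ht'⟩ := xiL_eq_cons k b
      simp only [ht, ht', xiW_cons]
      simp
      exact (List.isChain_cons_cons.1 h).1.xiW hk

lemma xiPow_succ (k n : ℕ) : xiPow k (n + 1) = xiW k (xiPow k n) := by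
  simp [xiPow, Function.iterate_succ_apply']

lemma xiIter_succ (k : ℕ) (r : Bool) (n : ℕ) : xiIter k r (n + 1) = xiW k (xiIter k r n) := by
  simp [xiIter, Function.iterate_succ_apply']

lemma isChain_xiPow {k : ℕ} (hk : 4 ≤ k) (n : ℕ) : (xiPow k n).IsChain (Adj k) := by
  induction n with
  | zero => simp [xiPow]
  | succ n ih => rw [xiPow_succ]; exact isChain_xiW hk ih

namespace Lang

lemma of_isInfix {k : ℕ} {v w : List Letter} (hw : Lang k w) (h : v <:+: w) : Lang k v :=
  hw.imp fun _ hn => h.trans hn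

lemma adj {k : ℕ} (hk : 4 ≤ k) {p q : List Letter} {c d : Letter}
    (h : Lang k (p ++ c :: d :: q)) : Adj k c d := by
  obtain ⟨n, s, t, hn⟩ := h
  have hc := isChain_xiPow hk n
  rw [← hn] at hc
  exact (List.isChain_cons_cons.1 hc.left_of_append.right_of_append.right_of_append).1

/-- Desubstitution of a factor. -/
lemma exists_xiW {k : ℕ} {w : List Letter} (h : Lang k w) :
    ∃ V p q, Lang k V ∧ xiW k V = p ++ (w ++ q) ∧ Lang k (xiW k V) := by
  obtain ⟨n, hn⟩ := h
  have h1 : w <:+: xiPow k (n + 1) := by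
    refine hn.trans ?_
    have : ∀ n, xiPow k n <+: xiPow k (n + 1) := by
      intro n
      refine ⟨(xiW k)^[n] [(false, 1)], ?_⟩
      rw [xiPow, xiPow, ← xiW_iterate_append]
      rfl
    exact (this n).isInfix
  obtain ⟨p, q, hpq⟩ := h1
  rw [xiPow_succ] at hpq
  refine ⟨xiPow k n, p, q, ⟨n, List.infix_refl _⟩, by simpa using hpq.symm, n + 1, ?_⟩
  rw [xiPow_succ]

/-- Desubstitution of a factor together with what follows it. -/
lemma exists_right {k : ℕ} {w t : List Letter} {c : Letter} (h : Lang k (w ++ c :: t))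
    (hw : ∀ d ∈ w.head?, d.2 ≠ 1) (hc : c.2 ≠ 1) :
    ∃ v c' V q, xiW k v = w ∧ Lang k (v ++ c' :: V) ∧ xiHead k c' = c ∧
      xiW k (c' :: V) = c :: (t ++ q) := by
  obtain ⟨V, p, q, hV, hVe, -⟩ := h.exists_xiW
  obtain ⟨V₁, V₂, rfl, -, h2⟩ := exists_of_xiW_eq_append hVe (by
    rcases w with _ | ⟨d, w⟩
    · simpa using hc
    · simpa using hw)
  rw [List.append_assoc] at h2
  obtain ⟨v, V₃, rfl, h3, h4⟩ := exists_of_xiW_eq_append h2 (by simpa using hc)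
  rcases V₃ with _ | ⟨c', V₃⟩
  · simp at h4
  · refine ⟨v, c', V₃, q, h3, hV.of_isInfix (List.suffix_append _ _).isInfix, ?_, by simpa using h4⟩
    obtain ⟨t', ht'⟩ := xiL_eq_cons k c'
    simp [ht'] at h4
    exact h4.1

/-- Desubstitution of a factor together with the letter before it. -/
lemma exists_left {k : ℕ} {w t : List Letter} {a : Letter} (h : Lang k (a :: (w ++ t)))
    (hw : ∀ d ∈ w.head?, d.2 ≠ 1) (hne : w ≠ [])
    (ht : ∀ q, Lang k (w ++ (t ++ q)) → ∀ c ∈ (t ++ q).head?, c.2 ≠ 1) :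
    ∃ v a', xiW k v = w ∧ Lang k (a' :: v) ∧ xiLast k a' = a := by
  obtain ⟨V, p, q, hV, hVe, hL⟩ := h.exists_xiW
  have hVe' : xiW k V = (p ++ [a]) ++ (w ++ (t ++ q)) := by simpa using hVe
  have hq := ht q (by
    rw [hVe'] at hL
    exact hL.of_isInfix (List.suffix_append _ _).isInfix)
  obtain ⟨V₁, V₂, rfl, h1, h2⟩ := exists_of_xiW_eq_append hVe' (by
    rcases w with _ | ⟨d, w⟩
    · exact absurd rfl hne
    · simpa using hw)
  obtain ⟨v, V₃, rfl, h3, -⟩ := exists_of_xiW_eq_append h2 hq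
  rcases List.eq_nil_or_concat' V₁ with rfl | ⟨V₁, a', rfl⟩
  · simp at h1
  · refine ⟨v, a', h3, hV.of_isInfix ⟨V₁, V₃, by simp⟩, ?_⟩
    obtain ⟨t', ht'⟩ := xiL_eq_concat k a'
    have := congrArg List.getLast? h1
    simpa [ht'] using this

lemma eq_of_cons {k : ℕ} (hk : 4 ≤ k) {w : List Letter} {a b c : Letter}
    (ha : Lang k (a :: c :: w)) (hb : Lang k (b :: c :: w)) (hc : c.2 ≠ 0) : a = b := by
  have h1 := ha.adj (p := []) hk
  have h2 := hb.adj (p := []) hk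
  simp only [Adj] at h1 h2
  ext
  · grind
  · omega

end Lang

lemma eq_of_xiHead_eq_zero {k : ℕ} {c : Letter} {t : Bool} (h : xiHead k c = (t, 0)) :
    c = (t, 0) ∨ c = (!t, k - 1) := by
  obtain ⟨s, i⟩ := c
  simp only [xiHead] at h
  split_ifs at h <;> simp_all

lemma eq_of_xiHead_eq_succ {k : ℕ} {c : Letter} {t : Bool} {j : ℕ}
    (h : xiHead k c = (t, j + 1)) : c = (t, j) := by
  obtain ⟨s, i⟩ := c
  simp only [xiHead] at h
  split_ifs at h <;> simp_all

lemma xiHead_ne_one {k : ℕ} (c : Letter) : (xiHead k c).2 ≠ 1 := by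
  unfold xiHead
  split_ifs <;> simp_all

lemma head_xiW_ne_one {k : ℕ} (V : List Letter) : ∀ d ∈ (xiW k V).head?, d.2 ≠ 1 := by
  rcases V with _ | ⟨a, V⟩
  · simp
  · obtain ⟨t, ht⟩ := xiL_eq_cons k a
    simp only [xiW_cons, ht]
    simpa using xiHead_ne_one a

lemma xiW_eq_zero_one {k : ℕ} {c : Letter} {V q : List Letter} {t : Bool}
    (h : xiW k (c :: V) = (t, 0) :: (t, 1) :: q) : c = (t, 0) ∧ xiW k V = q := by
  obtain ⟨s, i⟩ := c
  rw [xiW_cons] at h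
  unfold xiL at h
  split_ifs at h with h1 h2
  · simp_all
  · simp at h
    have := head_xiW_ne_one (k := k) V (t, 1) (by simp [h.2])
    simp at this
  · simp at h

lemma xiW_eq_zero_zero {k : ℕ} {c : Letter} {V q : List Letter} {t t' : Bool}
    (h : xiW k (c :: V) = (t, 0) :: (t', 0) :: q) :
    c = (!t, k - 1) ∧ xiW k V = (t', 0) :: q := by
  obtain ⟨s, i⟩ := c
  rw [xiW_cons] at h
  unfold xiL at h
  split_ifs at h with h1 h2
  · simp_all
  · simp_all
  · simp at h

lemma exists_cons_of_xiW_eq_cons {k : ℕ} {V q : List Letter} {c : Letter}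
    (h : xiW k V = c :: q) : ∃ c' V', V = c' :: V' ∧ xiHead k c' = c := by
  rcases V with _ | ⟨a, V⟩
  · simp at h
  · obtain ⟨t, ht⟩ := xiL_eq_cons k a
    simp [ht] at h
    exact ⟨a, V, rfl, h.1⟩

lemma Lang.pull {k : ℕ} (hk : 4 ≤ k) {z : List Letter} {t : Bool} {j : ℕ} (hj : 1 ≤ j)
    (h : Lang k (xiW k z ++ [(t, j + 1), (t, 0)])) : Lang k (z ++ [(t, j), (t, 0)]) := by
  obtain ⟨v, c, V, q, hv, hL, hc, hV⟩ := h.exists_right (head_xiW_ne_one z) (by simp; omega)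
  obtain rfl := xiW_injective hv
  obtain rfl := eq_of_xiHead_eq_succ hc
  have hL1 : xiL k (t, j) = [(t, j + 1)] := by
    rw [xiW_cons] at hV
    unfold xiL at hV ⊢
    split_ifs at hV ⊢ <;> simp_all
  simp [hL1] at hV
  obtain ⟨c, V', rfl, hc'⟩ := exists_cons_of_xiW_eq_cons hV
  rcases eq_of_xiHead_eq_zero hc' with rfl | rfl
  · exact hL.of_isInfix ⟨[], V', by simp⟩
  · have := hL.adj hk
    simp [Adj] at this
    omega

lemma Lang.pull_iterate {k : ℕ} (hk : 4 ≤ k) {z : List Letter} {t : Bool} (m : ℕ)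
    (h : Lang k ((xiW k)^[m] z ++ [(t, m + 1), (t, 0)])) : Lang k (z ++ [(t, 1), (t, 0)]) := by
  induction m with
  | zero => exact h
  | succ m ih =>
    rw [Function.iterate_succ_apply'] at h
    exact ih (Lang.pull hk (by omega) h)

lemma iterate_xiW_one {k : ℕ} (r : Bool) {m : ℕ} (hm : m + 2 ≤ k) :
    (xiW k)^[m] [(r, 1)] = [(r, m + 1)] := by
  induction m with
  | zero => rfl
  | succ m ih =>
    rw [Function.iterate_succ_apply', ih (by omega)]
    have h : m + 1 ≠ k - 1 := by omega
    simp [xiL, h]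

lemma xiIter_succ' (k : ℕ) (r : Bool) (m : ℕ) :
    xiIter k r (m + 1) = xiIter k r m ++ (xiW k)^[m] [(r, 1)] := by
  rw [xiIter, xiIter, ← xiW_iterate_append]
  rfl

lemma xiIter_succ_of_lt {k : ℕ} (r : Bool) {m : ℕ} (hm : m + 2 ≤ k) :
    xiIter k r (m + 1) = xiIter k r m ++ [(r, m + 1)] := by
  rw [xiIter_succ', iterate_xiW_one r hm]

lemma xiIter_add (k : ℕ) (hk : 4 ≤ k) (r : Bool) (m : ℕ) :
    xiIter k r (k + m) = xiIter k r (k - 1 + m) ++ xiIter k (!r) m := by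
  obtain ⟨n, rfl⟩ : ∃ n, k = n + 2 := ⟨k - 2, by omega⟩
  rw [show n + 2 + m = (m + (n + 1)) + 1 by omega, xiIter_succ',
    show n + 2 - 1 + m = m + (n + 1) by omega, Function.iterate_add_apply,
    Function.iterate_succ_apply', iterate_xiW_one r (by omega)]
  simp [xiL, xiIter]

lemma getLast?_xiIter {k : ℕ} (r : Bool) {m : ℕ} (hm : m + 1 ≤ k) :
    (xiIter k r m).getLast? = some (r, m) := by
  cases m with
  | zero => rfl
  | succ m => rw [xiIter_succ_of_lt r hm]; simp

lemma getLast?_xiIter_add {k : ℕ} (hk : 4 ≤ k) (r : Bool) {m : ℕ} (hm : m + 1 ≤ k) :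
    (xiIter k r (k + m)).getLast? = some (!r, m) := by
  rw [xiIter_add k hk, List.getLast?_append, getLast?_xiIter _ hm]
  rfl

lemma not_lang_xiIter {k : ℕ} (hk : 4 ≤ k) (r : Bool) :
    ¬ Lang k (xiIter k r (2 * k - 2) ++ [(!r, k - 1), (!r, 0)]) := by
  intro h
  rw [show 2 * k - 2 = k - 2 + k by omega, xiIter, Function.iterate_add_apply,
    show k - 1 = k - 2 + 1 by omega] at h
  have h1 := Lang.pull_iterate hk _ h
  change Lang k (xiIter k r k ++ _) at h1
  have e := xiIter_add k hk r 0
  rw [show k + 0 = k from rfl] at e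
  rw [e, show k - 1 + 0 = k - 2 + 1 by omega, xiIter_succ] at h1
  change Lang k ((xiW k (xiIter k r (k - 2)) ++ [(!r, 0)]) ++ [(!r, 1), (!r, 0)]) at h1
  rw [List.append_assoc] at h1
  obtain ⟨v, c, V, q, hv, hL, -, hV⟩ := h1.exists_right (head_xiW_ne_one _) (by simp)
  obtain rfl := xiW_injective hv
  obtain ⟨rfl, hV₁⟩ := xiW_eq_zero_one hV
  obtain ⟨c, V', rfl, hc'⟩ := exists_cons_of_xiW_eq_cons hV₁
  rcases eq_of_xiHead_eq_zero hc' with rfl | rfl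
  · have h2 : Lang k (xiW k (xiIter k r (k - 3)) ++ (!r, 0) :: [(!r, 0)]) := by
      rw [← xiIter_succ, show k - 3 + 1 = k - 2 by omega]
      exact hL.of_isInfix ⟨[], V', by simp⟩
    obtain ⟨v, c, V, q, hv, hL, -, hV⟩ := h2.exists_right (head_xiW_ne_one _) (by simp)
    obtain rfl := xiW_injective hv
    obtain ⟨rfl, -⟩ := xiW_eq_zero_zero hV
    rw [show k - 3 = k - 4 + 1 by omega, xiIter_succ_of_lt r (by omega)] at hL
    have := (show Lang k (xiIter k r (k - 4) ++ (r, k - 4 + 1) :: (!!r, k - 1) :: V) by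
      simpa using hL).adj hk
    simp [Adj] at this
    omega
  · have := hL.adj hk
    simp [Adj] at this
    omega

/-- A left special word with two distinct right extensions of equal projection has the form
`ξ^ℓ(0)` or `ξ^ℓ(0′)`. -/
lemma Lang.exists_eq_xiIter {k : ℕ} (hk : 4 ≤ k) (w : List Letter) (hne : w ≠ [])
    {a b : Letter} (hab : a ≠ b) (ha : Lang k (a :: w)) (hb : Lang k (b :: w))
    {x y : Letter} (hxy : x ≠ y) (hx : Lang k (w ++ [x])) (hy : Lang k (w ++ [y]))
    (hproj : proj x = proj y) :
    ∃ r ℓ, ℓ ≤ 2 * k - 2 ∧ ℓ ≠ k - 1 ∧ w = xiIter k r ℓ := by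
  induction hn : w.length using Nat.strong_induction_on generalizing w a b x y with
  | _ n ih =>
  subst hn
  have hhead : ∀ d ∈ w.head?, d.2 = 0 := by
    intro d hd
    rcases w with _ | ⟨c, w⟩
    · simp at hd
    · simp at hd
      subst hd
      by_contra hc
      exact hab (Lang.eq_of_cons hk ha hb hc)
  obtain ⟨w₁, ⟨s, i⟩, rfl⟩ := (List.eq_nil_or_concat' w).resolve_left hne
  have hx' : Lang k (w₁ ++ (s, i) :: x :: []) := by simpa using hx
  have hy' : Lang k (w₁ ++ (s, i) :: y :: []) := by simpa using hy
  wlog hx0 : x = (s, i + 1) ∧ y = (!s, 0) ∧ i + 1 < k generalizing x y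
  · refine this hxy.symm hproj.symm hy hx hy' hx' ?_
    have hax := hx'.adj hk
    have hay := hy'.adj hk
    obtain ⟨x1, x2⟩ := x
    obtain ⟨y1, y2⟩ := y
    simp only [Adj, proj] at hax hay hproj hxy hx0 ⊢
    grind
  obtain ⟨rfl, rfl, hik⟩ := hx0
  clear hx' hy' hproj hxy
  by_cases hi : i = 0
  · subst hi
    by_cases hw₁ : w₁ = []
    · subst hw₁
      exact ⟨s, 0, by omega, by omega, rfl⟩
    have hh : ∀ d ∈ w₁.head?, d.2 ≠ 1 := by
      intro d hd
      have := hhead d (by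
        rcases w₁ with _ | ⟨c, w₁⟩
        · simp at hd
        · simpa using hd)
      omega
    obtain ⟨v, a', rfl, hav, rfl⟩ := ha.exists_left hh hw₁ (by simp)
    obtain ⟨v', b', hv', hbv, rfl⟩ := hb.exists_left hh hw₁ (by simp)
    obtain rfl := xiW_injective hv'
    rw [List.append_assoc] at hx hy
    obtain ⟨v', c, V, q, hv', hcL, -, hV⟩ := hx.exists_right hh (by simp)
    obtain rfl := xiW_injective hv'
    obtain ⟨rfl, -⟩ := xiW_eq_zero_one hV
    obtain ⟨v', c, V', q', hv', hcL', -, hV'⟩ := hy.exists_right hh (by simp)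
    obtain rfl := xiW_injective hv'
    obtain ⟨rfl, hV₁⟩ := xiW_eq_zero_zero hV'
    obtain ⟨c, V'', rfl, hc⟩ := exists_cons_of_xiW_eq_cons hV₁
    have hc0 : c = (!s, 0) := by
      rcases eq_of_xiHead_eq_zero hc with rfl | rfl
      · rfl
      · have := hcL'.adj hk
        simp [Adj] at this
        omega
    subst hc0
    have hvne : v' ≠ [] := by rintro rfl; simp at hw₁
    obtain ⟨r, ℓ, hℓ, hℓ', rfl⟩ := ih v'.length (by
        have := length_le_length_xiW k v'
        simp
        omega) v' hvne (fun h => hab (by rw [h])) hav hbv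
      (x := (s, 0)) (y := (!s, k - 1)) (by simp)
      (hcL.of_isInfix ⟨[], V, by simp⟩) (hcL'.of_isInfix ⟨[], (!s, 0) :: V'', by simp⟩)
      (by have : k - 1 ≠ 0 := by omega
          simp [proj, this]) rfl
    have hlast : (xiIter k r ℓ).getLast? = some (!s, k - 2) := by
      obtain ⟨z, e, he⟩ := (List.eq_nil_or_concat' (xiIter k r ℓ)).resolve_left hvne
      rw [he] at hcL' ⊢
      have := (show Lang k (z ++ e :: (!s, k - 1) :: (!s, 0) :: V'') by simpa using hcL').adj hk
      simp only [Adj] at this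
      simp
      ext
      · grind
      · simp; omega
    rcases lt_or_ge ℓ k with hlt | hge
    · rw [getLast?_xiIter r hlt] at hlast
      simp at hlast
      obtain ⟨rfl, rfl⟩ := hlast
      refine ⟨!s, k, by omega, by omega, ?_⟩
      have e := xiIter_add k hk (!s) 0
      rw [← xiIter_succ, show k - 2 + 1 = k - 1 by omega]
      simpa [xiIter] using e.symm
    · obtain ⟨m, rfl⟩ := Nat.exists_eq_add_of_le hge
      rw [getLast?_xiIter_add hk r (by omega)] at hlast
      simp at hlast
      obtain ⟨rfl, rfl⟩ := hlast
      refine absurd (hcL'.of_isInfix ⟨[], V'', ?_⟩) (not_lang_xiIter hk r)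
      rw [show 2 * k - 2 = k + (k - 2) by omega]
      simp
  · have hh : ∀ d ∈ (w₁ ++ [(s, i)]).head?, d.2 ≠ 1 := by
      intro d hd
      have := hhead d hd
      omega
    have hq : ∀ q, Lang k ((w₁ ++ [(s, i)]) ++ ([] ++ q)) →
        ∀ c ∈ (([] : List Letter) ++ q).head?, c.2 ≠ 1 := by
      rintro (_ | ⟨c, q⟩) hq
      · simp
      · have := (show Lang k (w₁ ++ (s, i) :: c :: q) by simpa using hq).adj hk
        simp only [Adj] at this
        simp
        omega
    rw [← List.append_nil (w₁ ++ [(s, i)])] at ha hb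
    obtain ⟨v, a', hv, hav, rfl⟩ := ha.exists_left hh hne hq
    obtain ⟨v', b', hv', hbv, rfl⟩ := hb.exists_left hh hne hq
    obtain rfl := xiW_injective (hv.trans hv'.symm)
    obtain ⟨v', c, V, -, hv', hcL, hc, -⟩ := hx.exists_right hh (by simpa using hi)
    obtain rfl := xiW_injective (hv.trans hv'.symm)
    obtain rfl := eq_of_xiHead_eq_succ hc
    obtain ⟨v', c', V', -, hv', hcL', hc', -⟩ := hy.exists_right hh (by simp)
    obtain rfl := xiW_injective (hv.trans hv'.symm)
    have hab' : a' ≠ b' := fun h => hab (by rw [h])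
    obtain ⟨d, z, rfl⟩ : ∃ d z, v = d :: z :=
      List.exists_cons_of_ne_nil (by rintro rfl; simp at hv)
    have hd : d.2 = 0 := by
      by_contra hd
      exact hab' (Lang.eq_of_cons hk hav hbv hd)
    have hne' : (s, i) ≠ c' := by
      rintro rfl
      rw [hc] at hc'
      simp at hc'
    obtain ⟨r, ℓ, hℓ, hℓ', he⟩ := ih (d :: z).length (by
        have := length_le_length_xiW k z
        rw [← hv]
        simp [xiL, hd]
        omega) (d :: z) (by simp) hab' hav hbv
      (x := (s, i)) (y := c') hne'
      (hcL.of_isInfix ⟨[], V, by simp⟩) (hcL'.of_isInfix ⟨[], V', by simp⟩)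
      (by have : k - 1 ≠ 0 := by omega
          rcases eq_of_xiHead_eq_zero hc' with rfl | rfl <;> simp [proj, this, hi]) rfl
    rw [he, ← xiIter_succ] at hv
    have hlast : (xiIter k r (ℓ + 1)).getLast? = some (s, i) := by rw [hv]; simp
    refine ⟨r, ℓ + 1, ?_, ?_, hv.symm⟩
    · by_contra hcon
      rw [show ℓ + 1 = k + (k - 1) by omega, getLast?_xiIter_add hk r (by omega)] at hlast
      simp at hlast
      omega
    · intro hcon
      rw [hcon, getLast?_xiIter r (by omega)] at hlast
      simp at hlast
      omega

lemma map_twin_xiW (k : ℕ) (w : List Letter) : (xiW k w).map twin = xiW k (w.map twin) := by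
  induction w with
  | nil => rfl
  | cons a w ih =>
    rw [xiW_cons, List.map_append, ih, List.map_cons, xiW_cons]
    congr 1
    simp only [xiL, twin]
    split_ifs <;> simp_all [twin]

lemma map_twin_xiIter (k : ℕ) (r : Bool) (n : ℕ) :
    (xiIter k r n).map twin = xiIter k (!r) n := by
  induction n with
  | zero => rfl
  | succ n ih => rw [xiIter_succ, map_twin_xiW, ih, xiIter_succ]

lemma lt_length_xiPow (k n : ℕ) : n < (xiPow k n).length := by
  suffices h : ∀ n, ∃ t, xiPow k n = (false, 0) :: t ∧ n ≤ t.length by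
    obtain ⟨t, ht, hn⟩ := h n
    simp [ht]
    omega
  intro n
  induction n with
  | zero => exact ⟨[], rfl, by simp⟩
  | succ n ih =>
    obtain ⟨t, ht, hn⟩ := ih
    refine ⟨(false, 1) :: xiW k t, by simp [xiPow_succ, ht, xiL], ?_⟩
    have := length_le_length_xiW k t
    simp
    omega

lemma FactorOf.lang {k : ℕ} {u : ℕ → Letter} (hu : IsFixedPoint k u) {w : List Letter}
    (hw : FactorOf w u) : Lang k w := by
  obtain ⟨j, hj⟩ := hw
  refine ⟨j + w.length, List.infix_iff_getElem?.2 ⟨j, ?_, ?_⟩⟩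
  · have := lt_length_xiPow k (j + w.length)
    omega
  · intro i hi
    have h1 := hu (j + w.length) (i + j) (by
      have := lt_length_xiPow k (j + w.length)
      omega)
    have h2 := hj i hi
    rw [List.getElem?_eq_getElem hi] at h2
    rw [h1, h2]
    congr 2
    omega

/-- for `k ≥ 4`, if `w ≠ ε` is a bispecial factor of `u_k` having two
distinct right extensions `x ≠ y` with `π(x) = π(y)`, then `w` or its twin equals
`ξ^ℓ(0)` for some `0 ≤ ℓ ≤ 2k − 2` with `ℓ ≠ k − 1`. -/
theorem stmt_13 (k : ℕ) (hk : 4 ≤ k) (u : ℕ → Letter) (hu : IsFixedPoint k u)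
    (w : List Letter) (hw : FactorOf w u) (hne : w ≠ []) (hbs : Bispecial w u)
    (x y : Letter) (hxy : x ≠ y) (hx : x ∈ Rext w u) (hy : y ∈ Rext w u)
    (hproj : proj x = proj y) :
    ∃ ℓ : ℕ, ℓ ≤ 2 * k - 2 ∧ ℓ ≠ k - 1 ∧ (w = xiPow k ℓ ∨ w.map twin = xiPow k ℓ) := by
  obtain ⟨⟨a, b, hab, ha, hb⟩, -⟩ := hbs
  obtain ⟨r, ℓ, h1, h2, rfl⟩ := Lang.exists_eq_xiIter hk w hne hab (ha.lang hu) (hb.lang hu) hxy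
    (FactorOf.lang hu hx) (FactorOf.lang hu hy) hproj
  refine ⟨ℓ, h1, h2, ?_⟩
  rw [map_twin_xiIter]
  cases r
  · exact Or.inl rfl
  · exact Or.inr rfl
end
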